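/- Let p be an odd prime. Then t_{(p-1)/2} ≡ p·B_{p-1} - p + 2^{p-1} - 1 (mod p²), where (t_n) is the sequence defined below and B_{p-1} is the (p-1)-th Bernoulli number. -/

import Mathlib

/-- The sequence `t_0 = 1`, `t_1 = 5`,
`t_{n+1} = (8n²+12n+5) t_n - 4n²(2n+1)² t_{n-1}` for `n ≥ 1`. -/
def t : ℕ → ℤ
  | 0 => 1
  | 1 => 5
  | (n + 2) => (8 * ((n : ℤ) + 1) ^ 2 + 12 * ((n : ℤ) + 1) + 5) * t (n + 1)
      - 4 * ((n : ℤ) + 1) ^ 2 * (2 * ((n : ℤ) + 1) + 1) ^ 2 * t n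

/-- `a ≡ b (mod p^r)` for rationals: `a - b` is `p^r` times a rational whose
denominator (in lowest terms) is not divisible by `p`. -/
def pcong (p r : ℕ) (a b : ℚ) : Prop :=
  ∃ q : ℚ, a - b = (p : ℚ) ^ r * q ∧ ¬ (p ∣ q.den)

/-- Modulo the square of a common divisor of the `x i`, the product `∏ (1 + x i)` is linear. -/
lemma prod_one_add_modEq {ι : Type*} (s : Finset ι) (d : ℤ) (x : ι → ℤ)
    (hx : ∀ i ∈ s, d ∣ x i) :
    ∏ i ∈ s, (1 + x i) ≡ 1 + ∑ i ∈ s, x i [ZMOD d ^ 2] := by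
  classical
  induction s using Finset.induction_on with
  | empty => simp
  | insert a s ha ih =>
    rw [Finset.prod_insert ha, Finset.sum_insert ha]
    have hs : d ∣ ∑ i ∈ s, x i :=
      Finset.dvd_sum fun i hi => hx i (Finset.mem_insert_of_mem hi)
    obtain ⟨u, hu⟩ := hx a (Finset.mem_insert_self a s)
    obtain ⟨v, hv⟩ := hs
    refine ((ih fun i hi => hx i (Finset.mem_insert_of_mem hi)).mul_left _).trans ?_
    rw [hu, hv]
    exact (Int.modEq_iff_dvd.2 ⟨u * v, by ring⟩).symm

/-- A first-order recurrence for `t`. -/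
lemma t_succ (n : ℕ) :
    t (n + 1) = 4 * ((n : ℤ) + 1) ^ 2 * t n + (∏ j ∈ Finset.range (n + 1), (2 * (j : ℤ) + 1)) ^ 2 := by
  induction n with
  | zero => simp [t]
  | succ n ih =>
    rw [t, Finset.prod_range_succ]
    push_cast
    linear_combination (2 * (n : ℤ) + 3) ^ 2 * ih

/-- The summand of the shifted Legendre polynomial at `1`, cleared of denominators. -/
lemma four_pow_mul_choose_mul_choose (m n : ℕ) (h : n ≤ m) :
    (4 : ℤ) ^ n * (n.factorial : ℤ) ^ 2 * (m.choose n * (m + n).choose m) =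
      ∏ j ∈ Finset.range n, ((2 * (m : ℤ) + 1) ^ 2 - (2 * (j : ℤ) + 1) ^ 2) := by
  induction n with
  | zero => simp
  | succ n ih =>
    rw [Finset.prod_range_succ, ← ih (by omega), Nat.factorial_succ]
    have h1 : (m.choose (n + 1) : ℤ) * (n + 1) = m.choose n * (m - n) := by
      have := Nat.choose_succ_right_eq m n
      rw [← Nat.cast_sub (by omega)]
      exact_mod_cast this
    have h2 : ((m + (n + 1)).choose m : ℤ) * (n + 1) = (m + n + 1) * (m + n).choose m := by
      have := Nat.choose_mul_succ_eq (m + n) m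
      rw [show m + n + 1 - m = n + 1 by omega] at this
      rw [← add_assoc]
      exact_mod_cast (by linarith : (m + n + 1).choose m * (n + 1) = (m + n + 1) * (m + n).choose m)
    push_cast
    linear_combination (4 : ℤ) ^ (n + 1) * (n.factorial : ℤ) ^ 2 *
      (((m + (n + 1)).choose m : ℤ) * (n + 1) * h1 + m.choose n * (m - n) * h2)

lemma four_pow_mul_choose_modEq (m n : ℕ) (h : n ≤ m) :
    (4 : ℤ) ^ n * (n.factorial : ℤ) ^ 2 * ((-1) ^ n * m.choose n * (m + n).choose m) ≡
      (∏ j ∈ Finset.range n, (2 * (j : ℤ) + 1)) ^ 2 [ZMOD (2 * (m : ℤ) + 1) ^ 2] := by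
  have key : (4 : ℤ) ^ n * (n.factorial : ℤ) ^ 2 * ((-1) ^ n * m.choose n * (m + n).choose m) =
      ∏ j ∈ Finset.range n, ((2 * (j : ℤ) + 1) ^ 2 - (2 * (m : ℤ) + 1) ^ 2) := by
    have hneg : ∏ j ∈ Finset.range n, ((2 * (j : ℤ) + 1) ^ 2 - (2 * (m : ℤ) + 1) ^ 2) =
        (-1) ^ n * ∏ j ∈ Finset.range n, ((2 * (m : ℤ) + 1) ^ 2 - (2 * (j : ℤ) + 1) ^ 2) := by
      rw [← Finset.card_range n, ← Finset.prod_const, Finset.card_range, ← Finset.prod_mul_distrib]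
      exact Finset.prod_congr rfl fun _ _ => by ring
    rw [hneg, ← four_pow_mul_choose_mul_choose m n h]
    ring
  rw [key, ← Finset.prod_pow]
  exact Int.ModEq.prod fun j _ => Int.modEq_iff_dvd.2 ⟨1, by ring⟩

lemma t_modEq_sum (m n : ℕ) (h : n ≤ m) :
    t n ≡ 4 ^ n * (n.factorial : ℤ) ^ 2 *
      ∑ k ∈ Finset.range (n + 1), (-1) ^ k * (m.choose k : ℤ) * (m + k).choose m
      [ZMOD (2 * (m : ℤ) + 1) ^ 2] := by
  induction n with
  | zero => simp [t]
  | succ n ih =>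
    rw [t_succ, Finset.sum_range_succ, mul_add]
    refine Int.ModEq.add ?_ (four_pow_mul_choose_modEq m (n + 1) h).symm
    convert (ih (by omega)).mul_left (4 * ((n : ℤ) + 1) ^ 2) using 1
    rw [Nat.factorial_succ]
    push_cast
    ring

lemma sum_neg_one_pow_mul_choose_mul_choose (m : ℕ) :
    ∑ k ∈ Finset.range (m + 1), (-1) ^ k * (m.choose k : ℤ) * (m + k).choose m = (-1) ^ m := by
  have h := Polynomial.shiftedLegendre_eval_symm m (1 : ℤ)
  rw [sub_self, ← Polynomial.coeff_zero_eq_aeval_zero, Polynomial.coeff_shiftedLegendre] at h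
  simpa [Polynomial.shiftedLegendre] using h

lemma t_half_modEq (m : ℕ) :
    t m ≡ 4 ^ m * (m.factorial : ℤ) ^ 2 * (-1) ^ m [ZMOD (2 * (m : ℤ) + 1) ^ 2] := by
  simpa only [sum_neg_one_pow_mul_choose_mul_choose] using t_modEq_sum m m le_rfl

lemma prod_odd_mul_two_pow_mul_factorial (m : ℕ) :
    (∏ j ∈ Finset.range m, (2 * (j : ℤ) + 1)) * (2 ^ m * m.factorial) = (2 * m).factorial := by
  induction m with
  | zero => simp
  | succ m ih =>
    rw [Finset.prod_range_succ, show 2 * (m + 1) = 2 * m + 1 + 1 by ring, Nat.factorial_succ,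
      Nat.factorial_succ, Nat.factorial_succ]
    push_cast
    rw [← ih]
    ring

lemma isCoprime_factorial_sq {p n : ℕ} (hp : p.Prime) (h : n < p) :
    IsCoprime ((p : ℤ) ^ 2) (n.factorial : ℤ) := by
  refine IsCoprime.pow_left (Nat.isCoprime_iff_coprime.2 ?_)
  rw [hp.coprime_iff_not_dvd, hp.dvd_factorial]
  omega

/-- Morley's congruence modulo `p ^ 2`, in terms of factorials. -/
lemma sixteen_pow_mul_factorial_sq_modEq {p m : ℕ} (hp : p.Prime) (hm : p = 2 * m + 1) :
    16 ^ m * (m.factorial : ℤ) ^ 2 * (-1) ^ m ≡ (2 * m).factorial [ZMOD (p : ℤ) ^ 2] := by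
  have hpc : (p : ℤ) = 2 * m + 1 := by exact_mod_cast hm
  have h := (four_pow_mul_choose_modEq m m le_rfl).mul_left ((2 ^ m * (m.factorial : ℤ)) ^ 2)
  have hfac : ((m + m).choose m : ℤ) * m.factorial * m.factorial = (2 * m).factorial := by
    rw [two_mul]
    exact_mod_cast Nat.add_choose_mul_factorial_mul_factorial m m
  rw [← hpc] at h
  have h4 : (4 : ℤ) ^ m = (2 ^ m) ^ 2 := by rw [← pow_mul, mul_comm m, pow_mul]; norm_num
  have h16 : (16 : ℤ) ^ m = (2 ^ m) ^ 4 := by rw [← pow_mul, mul_comm m, pow_mul]; norm_num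
  have h' : ((2 * m).factorial : ℤ) * (16 ^ m * (m.factorial : ℤ) ^ 2 * (-1) ^ m) ≡
      (2 * m).factorial * (2 * m).factorial [ZMOD (p : ℤ) ^ 2] := by
    convert h using 1
    · rw [← hfac, h4, h16, Nat.choose_self]
      push_cast
      ring
    · rw [← mul_pow, mul_comm (2 ^ m * (m.factorial : ℤ)), prod_odd_mul_two_pow_mul_factorial]
      ring
  rw [Int.modEq_iff_dvd] at h' ⊢
  rw [← mul_sub] at h'
  exact (isCoprime_factorial_sq hp (by omega)).dvd_of_dvd_mul_left h'

lemma prime_dvd_pow_sub_one_sub_one {p : ℕ} (hp : p.Prime) {a : ℕ} (h0 : 0 < a) (h : a < p) :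
    (p : ℤ) ∣ (a : ℤ) ^ (p - 1) - 1 := by
  refine (Int.ModEq.pow_card_sub_one_eq_one hp ?_).symm.dvd
  rw [Nat.isCoprime_iff_coprime]
  exact (Nat.coprime_of_lt_prime h0.ne' h hp).symm

lemma prime_dvd_factorial_add_one {p : ℕ} (hp : p.Prime) :
    (p : ℤ) ∣ (p - 1).factorial + 1 := by
  have := Fact.mk hp
  rw [← ZMod.intCast_zmod_eq_zero_iff_dvd]
  push_cast
  rw [ZMod.wilsons_lemma]
  ring

lemma t_half_modEq_factorial {p m : ℕ} (hp : p.Prime) (hm : p = 2 * m + 1) :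
    t m ≡ (p - 1).factorial + 2 ^ (p - 1) - 1 [ZMOD (p : ℤ) ^ 2] := by
  have hpc : (p : ℤ) = 2 * m + 1 := by exact_mod_cast hm
  have hp1 : p - 1 = 2 * m := by omega
  have h4 : (4 : ℤ) ^ m = 2 ^ (p - 1) := by rw [hp1, pow_mul]; norm_num
  have h16 : (16 : ℤ) ^ m = 4 ^ m * 4 ^ m := by rw [← mul_pow]; norm_num
  have h := (t_half_modEq m).mul_left (4 ^ m)
  rw [← hpc, ← mul_assoc, ← mul_assoc, ← h16] at h
  have h' := h.trans (sixteen_pow_mul_factorial_sq_modEq hp hm)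
  rw [h4, ← hp1] at h'
  have h2 : 2 < p := by
    have := hp.two_le
    omega
  obtain ⟨u, hu⟩ := prime_dvd_pow_sub_one_sub_one hp two_pos h2
  obtain ⟨v, hv⟩ := prime_dvd_factorial_add_one hp
  obtain ⟨w, hw⟩ := Int.modEq_iff_dvd.1 h'
  have hcop : IsCoprime ((p : ℤ) ^ 2) (2 ^ (p - 1)) := by
    refine (IsCoprime.pow_left ?_).pow_right
    exact ⟨1, -m, by rw [hpc]; ring⟩
  rw [Int.modEq_iff_dvd]
  refine hcop.dvd_of_dvd_mul_left ⟨w + u * v + u ^ 2, ?_⟩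
  push_cast at hu
  linear_combination hw + (((p - 1).factorial : ℤ) + 1 + (2 ^ (p - 1) - 1) + p * u) * hu + p * u * hv

lemma sum_pow_modEq_factorial {p : ℕ} (hp : p.Prime) (hodd : Odd p) :
    ∑ a ∈ Finset.range p, (a : ℤ) ^ (p - 1) ≡ (p - 1).factorial + p [ZMOD (p : ℤ) ^ 2] := by
  obtain ⟨n, rfl⟩ : ∃ n, p = n + 1 := ⟨p - 1, by have := hp.pos; omega⟩
  have hn0 : n ≠ 0 := by
    rintro rfl
    exact hp.one_lt.ne' rfl
  have hn : Even n := by simpa [Nat.odd_add_one] using hodd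
  rw [Nat.add_sub_cancel, Finset.sum_range_succ']
  obtain ⟨v, hv⟩ := prime_dvd_factorial_add_one hp
  have hprod := prod_one_add_modEq (Finset.range n) ((n + 1 : ℕ) : ℤ)
    (fun a => ((a + 1 : ℕ) : ℤ) ^ n - 1) fun a ha =>
      prime_dvd_pow_sub_one_sub_one hp a.succ_pos (by simpa using ha)
  have hpow := prod_one_add_modEq (Finset.range n) ((n + 1 : ℕ) : ℤ)
    (fun _ => -(((n + 1 : ℕ) : ℤ) * v)) fun a ha => (Dvd.intro _ rfl).neg_right
  have hleft : ∏ a ∈ Finset.range n, (1 + (((a + 1 : ℕ) : ℤ) ^ n - 1)) =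
      ∏ _a ∈ Finset.range n, (1 + -(((n + 1 : ℕ) : ℤ) * v)) := by
    simp only [add_sub_cancel, Finset.prod_pow, Finset.prod_const, Finset.card_range]
    rw [← hv, ← hn.neg_pow, ← Nat.cast_prod, Finset.prod_range_add_one_eq_factorial]
    simp
  rw [hleft] at hprod
  obtain ⟨w, hw⟩ := Int.modEq_iff_dvd.1 (hprod.symm.trans hpow)
  simp only [Finset.sum_sub_distrib, Finset.sum_const, Finset.card_range] at hw
  rw [Int.modEq_iff_dvd]
  refine ⟨w + v, ?_⟩
  simp only [Nat.add_sub_cancel] at hv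
  simp only [Nat.cast_zero, zero_pow hn0, nsmul_eq_mul] at hw ⊢
  push_cast at hw hv ⊢
  linear_combination hw + hv

section PIntegral

variable (p : ℕ) [Fact p.Prime]

lemma mem_integer_padicValuation_iff (x : ℚ) : x ∈ (Rat.padicValuation p).integer ↔ ¬ p ∣ x.den :=
  Rat.padicValuation_le_one_iff

lemma inv_natCast_mem_integer {n : ℕ} (h : ¬ p ∣ n) : (n : ℚ)⁻¹ ∈ (Rat.padicValuation p).integer := by
  rw [mem_integer_padicValuation_iff]
  rcases n.eq_zero_or_pos with rfl | hn
  · simp at h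
  · rwa [Rat.inv_natCast_den_of_pos hn]

lemma bernoulli'_mem_integer (n : ℕ) (h : n + 1 < p) : bernoulli' n ∈ (Rat.padicValuation p).integer := by
  induction n using Nat.strong_induction_on with
  | _ n ih =>
    rw [bernoulli'_def]
    refine sub_mem (one_mem _) (sum_mem fun k hk => mul_mem ?_ (ih k ?_ ?_))
    · rw [Finset.mem_range] at hk
      rw [div_eq_mul_inv, ← Nat.cast_sub hk.le, ← Nat.cast_add_one]
      exact mul_mem (natCast_mem _ _)
        (inv_natCast_mem_integer p (Nat.not_dvd_of_pos_of_lt (by omega) (by omega)))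
    · simpa using hk
    · have := Finset.mem_range.1 hk
      omega

lemma bernoulli_mem_integer (n : ℕ) (h : n + 1 < p) : bernoulli n ∈ (Rat.padicValuation p).integer :=
  mul_mem (pow_mem (neg_mem (one_mem _)) _) (bernoulli'_mem_integer p n h)

lemma exists_sum_pow_eq_mul_bernoulli_add (hodd : Odd p) :
    ∃ q ∈ (Rat.padicValuation p).integer, ∑ a ∈ Finset.range p, (a : ℚ) ^ (p - 1) = p * bernoulli (p - 1) + (p : ℚ) ^ 2 * q := by
  have hp : p.Prime := Fact.out
  have hp3 : 3 ≤ p := by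
    have := hp.two_le
    rcases hodd with ⟨m, hm⟩
    omega
  have hp0 : (p : ℚ) ≠ 0 := by exact_mod_cast hp.ne_zero
  have hterm : ∀ i ∈ Finset.range (p - 1), ∃ q ∈ (Rat.padicValuation p).integer,
      bernoulli i * (p.choose i) * (p : ℚ) ^ (p - i) / p = (p : ℚ) ^ 2 * q := by
    intro i hi
    rw [Finset.mem_range] at hi
    rcases Nat.eq_zero_or_pos i with rfl | hi0
    · refine ⟨(p : ℚ) ^ (p - 3), pow_mem (natCast_mem _ _) _, ?_⟩
      rw [show p - 0 = (p - 3) + 3 by omega, pow_add]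
      simp
      field_simp
    · obtain ⟨c, hc⟩ := hp.dvd_choose_self hi0.ne' (by omega)
      refine ⟨bernoulli i * c * (p : ℚ) ^ (p - i - 2),
        mul_mem (mul_mem (bernoulli_mem_integer p i (by omega)) (natCast_mem _ _))
          (pow_mem (natCast_mem _ _) _), ?_⟩
      rw [hc, show p - i = (p - i - 2) + 2 by omega, pow_add, Nat.add_sub_cancel]
      push_cast
      field_simp
  choose! q hq hqe using hterm
  refine ⟨∑ i ∈ Finset.range (p - 1), q i, sum_mem hq, ?_⟩
  rw [sum_range_pow, Finset.sum_range_succ, Finset.mul_sum, add_comm]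
  have hp1 : p - 1 + 1 = p := by omega
  have hpq : ((p - 1 : ℕ) : ℚ) + 1 = p := by exact_mod_cast hp1
  rw [hp1, hpq]
  congr 1
  · rw [show p - (p - 1) = 1 by omega, ← Nat.choose_symm (by omega : p - 1 ≤ p),
      show p - (p - 1) = 1 by omega, Nat.choose_one_right]
    field_simp
  · exact Finset.sum_congr rfl hqe

end PIntegral

theorem t_half_cong (p : ℕ) (hp : p.Prime) (hodd : Odd p) :
    pcong p 2 ((t ((p - 1) / 2) : ℚ))
      ((p : ℚ) * bernoulli (p - 1) - p + 2 ^ (p - 1) - 1) := by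
  have := Fact.mk hp
  obtain ⟨m, hm⟩ := id hodd
  obtain ⟨q, hq, hqe⟩ := exists_sum_pow_eq_mul_bernoulli_add p hodd
  obtain ⟨u, hu⟩ := Int.modEq_iff_dvd.1 (t_half_modEq_factorial hp hm)
  obtain ⟨v, hv⟩ := Int.modEq_iff_dvd.1 (sum_pow_modEq_factorial hp hodd)
  rw [show (p - 1) / 2 = m by omega]
  refine ⟨q - u + v, ?_, (mem_integer_padicValuation_iff p _).1
    (add_mem (sub_mem hq (intCast_mem _ _)) (intCast_mem _ _))⟩
  have hu' := congrArg (Int.cast : ℤ → ℚ) hu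
  have hv' := congrArg (Int.cast : ℤ → ℚ) hv
  push_cast at hu' hv'
  linear_combination hqe - hu' + hv'
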